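/- arXiv:2106.01736 — 3 statements merged into one kernel-verified Lean document; each statement's English description precedes it below -/
import Mathlib

section
/- Assume the Riemann Hypothesis. For every non-negative integer k there exists t_0 = t_0(k) > 0 such that every zero ρ of Z_k with Im ρ ≥ t_0 and Re ρ ≠ 1/2 satisfies |Re ρ − 1/2| ≤ 1/9. -/
open Complex Finset

noncomputable def chi (s : ℂ) : ℂ :=
  2 ^ s * (Real.pi : ℂ) ^ (s - 1) * Complex.sin (Real.pi * s / 2) * Complex.Gamma (1 - s)

noncomputable def omega (s : ℂ) : ℂ :=
  Real.log (2 * Real.pi) + deriv Complex.Gamma s / Complex.Gamma s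
    - (Real.pi / 2) * Complex.tan (Real.pi * s / 2)

noncomputable def Zk : ℕ → ℂ → ℂ
  | 0 => riemannZeta
  | k + 1 => fun s => deriv (Zk k) s - (1 / 2) * omega s * Zk k s

noncomputable def fk : ℕ → ℂ → ℂ
  | 0 => fun _ => 1
  | k + 1 => fun s => deriv (fk k) s - (1 / 2) * omega s * fk k s

noncomputable def scrZ (k : ℕ) (T : ℝ) (s : ℂ) : ℂ :=
  ∑ μ ∈ Finset.range (k + 1),
    (k.choose μ : ℂ) * ((Real.log (T / (2 * Real.pi)) : ℂ) / 2) ^ (k - μ)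
      * iteratedDeriv μ riemannZeta s

/-- Order of vanishing of `f` at `ρ`: the least `n` with nonvanishing `n`-th derivative
(for analytic `f` this is the multiplicity of the zero). -/
noncomputable def zeroOrder (f : ℂ → ℂ) (ρ : ℂ) : ℕ :=
  sInf {n : ℕ | iteratedDeriv n f ρ ≠ 0}

lemma abs_log_sub_log_sub_inv_le (j : ℕ) :
    |Real.log j - Real.log (j - 1) - 1 / (j + 1)| ≤ 6 / ((j : ℝ) + 1) ^ 2 := by
  match j with
  | 0 => norm_num
  | 1 => norm_num [abs_of_pos]
  | j + 2 =>
    have hj : (0 : ℝ) ≤ j := j.cast_nonneg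
    push_cast
    rw [show (j : ℝ) + 2 - 1 = j + 1 by ring, ← Real.log_div (by positivity) (by positivity)]
    have h1 := Real.one_sub_inv_le_log_of_pos (x := ((j : ℝ) + 2) / (j + 1)) (by positivity)
    have h2 := Real.log_le_sub_one_of_pos (x := ((j : ℝ) + 2) / (j + 1)) (by positivity)
    have h3 : 1 - (((j : ℝ) + 2) / (j + 1))⁻¹ = 1 / (j + 2) := by field_simp; ring
    have h4 : ((j : ℝ) + 2) / (j + 1) - 1 = 1 / (j + 1) := by field_simp; ring
    have h5 : 1 / ((j : ℝ) + 2 + 1) ≤ 1 / (j + 2) :=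
      one_div_le_one_div_of_le (by positivity) (by linarith)
    have h6 : 1 / ((j : ℝ) + 1) - 1 / (j + 2 + 1) ≤ 6 / ((j : ℝ) + 2 + 1) ^ 2 := by
      rw [div_sub_div _ _ (by positivity) (by positivity), div_le_div_iff₀ (by positivity)
        (by positivity)]
      nlinarith [mul_nonneg hj hj, mul_nonneg (mul_nonneg hj hj) hj]
    have h7 : 0 ≤ 6 / ((j : ℝ) + 2 + 1) ^ 2 := by positivity
    rw [abs_le]
    constructor <;> linarith

lemma sum_range_log_sub_log (n : ℕ) :
    ∑ j ∈ range (n + 1), (Real.log j - Real.log (j - 1)) = Real.log n := by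
  induction n with
  | zero => simp
  | succ n ih => rw [sum_range_succ, ih]; push_cast; ring_nf

lemma natCast_add_one_le_mul_norm_add {z : ℂ} {R : ℝ} (hz : 1 / 2 < z.im) (hR : ‖z‖ < R) (j : ℕ) :
    (j : ℝ) + 1 ≤ (2 * R + 4) * ‖z + j‖ := by
  have h1 : 1 / 2 < ‖z + j‖ := by
    have := abs_im_le_norm (z + j)
    simp only [add_im, natCast_im, add_zero] at this
    linarith [le_abs_self z.im]
  have h2 : (j : ℝ) - R ≤ ‖z + j‖ := by
    have := norm_sub_norm_le (j : ℂ) (-z)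
    rw [sub_neg_eq_add, norm_neg, Complex.norm_natCast, add_comm] at this
    linarith
  have hR0 : 0 < R := (norm_nonneg z).trans_lt hR
  nlinarith

lemma norm_log_sub_log_sub_inv_le {z : ℂ} {R : ℝ} (hz : 1 / 2 < z.im) (hR : ‖z‖ < R) (j : ℕ) :
    ‖((Real.log j - Real.log (j - 1) : ℝ) : ℂ) - 1 / (z + j)‖ ≤
      (6 + (R + 1) * (2 * R + 4)) * (1 / ((j : ℝ) + 1) ^ 2) := by
  have hR0 : 0 < R := (norm_nonneg z).trans_lt hR
  have hj : (0 : ℝ) < (j : ℝ) + 1 := by positivity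
  have h1 := natCast_add_one_le_mul_norm_add hz hR j
  have h2 : 0 < ‖z + j‖ := by
    by_contra! h
    nlinarith
  have h3 : z + j ≠ 0 := norm_pos_iff.mp h2
  have hj' : (j : ℂ) + 1 ≠ 0 := by exact_mod_cast j.succ_ne_zero
  have h4 : ‖1 / ((j : ℂ) + 1) - 1 / (z + j)‖ ≤ (R + 1) * (2 * R + 4) * (1 / ((j : ℝ) + 1) ^ 2) := by
    have : 1 / ((j : ℂ) + 1) - 1 / (z + j) = (z - 1) / ((j + 1) * (z + j)) := by
      field_simp; ring
    rw [this, norm_div, norm_mul]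
    have hn : ‖(j : ℂ) + 1‖ = j + 1 := by
      exact_mod_cast Complex.norm_natCast (j + 1)
    rw [hn, mul_one_div, div_le_div_iff₀ (by positivity) (by positivity)]
    have h5 : ‖z - 1‖ ≤ R + 1 := (norm_sub_le _ _).trans (by simpa using hR.le)
    calc ‖z - 1‖ * ((j : ℝ) + 1) ^ 2 = ‖z - 1‖ * ((j + 1) * (j + 1)) := by ring
      _ ≤ (R + 1) * ((j + 1) * ((2 * R + 4) * ‖z + j‖)) := by gcongr
      _ = _ := by ring
  have h5 : ‖((Real.log j - Real.log (j - 1) : ℝ) : ℂ) - 1 / ((j : ℂ) + 1)‖ ≤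
      6 * (1 / ((j : ℝ) + 1) ^ 2) := by
    have := abs_log_sub_log_sub_inv_le j
    rw [mul_one_div, ← Real.norm_eq_abs, ← Complex.norm_real] at *
    simpa using this
  calc _ = ‖(((Real.log j - Real.log (j - 1) : ℝ) : ℂ) - 1 / ((j : ℂ) + 1))
        + (1 / ((j : ℂ) + 1) - 1 / (z + j))‖ := by ring_nf
    _ ≤ _ := norm_add_le _ _
    _ ≤ _ := by rw [add_mul]; gcongr

open Filter Topology in
/-- Euler's limit formula for the digamma function. -/
lemma tendsto_log_sub_sum_inv_logDeriv_Gamma {s : ℂ} (hs : 1 / 2 < s.im) :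
    Tendsto (fun n : ℕ ↦ (Real.log n : ℂ) - ∑ j ∈ range (n + 1), 1 / (s + j)) atTop
      (𝓝 (deriv Gamma s / Gamma s)) := by
  set R := ‖s‖ + 1 with hRdef
  set t : Set ℂ := {z | 1 / 2 < z.im} ∩ Metric.ball 0 R with ht
  have hto : IsOpen t := (isOpen_lt continuous_const continuous_im).inter Metric.isOpen_ball
  have htc : IsPreconnected t :=
    ((convex_halfSpace_im_gt _).inter (convex_ball _ _)).isPreconnected
  have hst : s ∈ t := ⟨hs, by simp [hRdef]⟩
  have hu : Summable fun j : ℕ ↦ (6 + (R + 1) * (2 * R + 4)) * (1 / ((j : ℝ) + 1) ^ 2) := by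
    apply Summable.mul_left
    exact_mod_cast (summable_nat_add_iff 1).mpr (Real.summable_one_div_nat_pow.mpr one_lt_two)
  set a : ℕ → ℂ := fun j ↦ ((Real.log j - Real.log (j - 1) : ℝ) : ℂ) with ha
  set g : ℕ → ℂ → ℂ := fun j z ↦ (z - s) * a j - (log (z + j) - log (s + j)) with hg
  set g' : ℕ → ℂ → ℂ := fun j z ↦ a j - 1 / (z + j) with hg'
  have hslit : ∀ z ∈ t, ∀ j : ℕ, z + j ∈ slitPlane := fun z hz j ↦ by
    have : 1 / 2 < z.im := hz.1
    refine mem_slitPlane_iff.mpr (.inr ?_)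
    simp only [add_im, natCast_im, add_zero]
    linarith
  have hder : ∀ n, ∀ z ∈ t, HasDerivAt (g n) (g' n z) z := fun n z hz ↦ by
    have h1 : HasDerivAt (fun z : ℂ ↦ (z - s) * a n) (a n) z := by
      simpa using ((hasDerivAt_id z).sub_const s).mul_const (a n)
    have h2 : HasDerivAt (fun z : ℂ ↦ log (z + n) - log (s + n)) (1 / (z + n)) z :=
      (((hasDerivAt_id z).add_const (n : ℂ)).clog (hslit z hz n)).sub_const _
    exact h1.sub h2
  have hbd : ∀ n, ∀ z ∈ t, ‖g' n z‖ ≤ (6 + (R + 1) * (2 * R + 4)) * (1 / ((n : ℝ) + 1) ^ 2) :=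
    fun n z hz ↦ norm_log_sub_log_sub_inv_le hz.1 (by simpa using hz.2) n
  have h0 : Summable fun n ↦ g n s := by simp [hg, summable_zero]
  have hG := hasDerivAt_tsum_of_isPreconnected hu hto htc hder hbd hst h0 hst
  have hlim := (Summable.of_norm_bounded hu (fun n ↦ hbd n s hst)).hasSum.tendsto_sum_nat
  have hsuma : ∀ n : ℕ, ∑ j ∈ range (n + 1), a j = (Real.log n : ℂ) := fun n ↦ by
    rw [ha, ← ofReal_sum, sum_range_log_sub_log]
  have hlim' : Tendsto (fun n : ℕ ↦ (Real.log n : ℂ) - ∑ j ∈ range (n + 1), 1 / (s + j)) atTop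
      (𝓝 (∑' n, g' n s)) := by
    refine (hlim.comp (tendsto_add_atTop_nat 1)).congr fun n ↦ ?_
    simp only [Function.comp_apply, hg', sum_sub_distrib, hsuma]
  have hne : ∀ z ∈ t, ∀ m : ℕ, z ≠ -m := fun z hz m h ↦ by
    have := hz.1
    simp [h] at this
    linarith
  have hGamma : ∀ z ∈ t, Gamma z = Gamma s * exp (∑' n, g n z) := fun z hz ↦ by
    have hsum := (summable_of_summable_hasDerivAt_of_isPreconnected hu hto htc hder hbd hst h0
      hz).hasSum.tendsto_sum_nat
    have h1 := ((continuous_exp.tendsto _).comp (hsum.comp (tendsto_add_atTop_nat 1))).const_mul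
      (Gamma s)
    have h2 := (GammaSeq_tendsto_Gamma z).div (GammaSeq_tendsto_Gamma s) (Gamma_ne_zero (hne s hst))
    have h3 := h2.const_mul (Gamma s)
    rw [mul_div_cancel₀ _ (Gamma_ne_zero (hne s hst))] at h3
    refine tendsto_nhds_unique h3 (h1.congr' ?_)
    filter_upwards [eventually_gt_atTop 0] with n hn
    have hn0 : (n : ℂ) ≠ 0 := by exact_mod_cast hn.ne'
    simp only [Function.comp_apply, hg, sum_sub_distrib, ← mul_sum, hsuma, Pi.div_apply,
      GammaSeq, exp_sub, exp_sum]
    rw [prod_congr rfl fun j _ ↦ exp_log (slitPlane_ne_zero (hslit z hz j)),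
      prod_congr rfl fun j _ ↦ exp_log (slitPlane_ne_zero (hslit s hst j)),
      sub_mul, exp_sub, cpow_def_of_ne_zero hn0, cpow_def_of_ne_zero hn0, natCast_log,
      mul_comm (log _) z, mul_comm (log _) s]
    have hf : (n.factorial : ℂ) ≠ 0 := by exact_mod_cast n.factorial_ne_zero
    have hp1 : ∏ j ∈ range (n + 1), (z + j) ≠ 0 :=
      prod_ne_zero_iff.mpr fun j _ ↦ slitPlane_ne_zero (hslit z hz j)
    have hp2 : ∏ j ∈ range (n + 1), (s + j) ≠ 0 :=
      prod_ne_zero_iff.mpr fun j _ ↦ slitPlane_ne_zero (hslit s hst j)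
    field_simp
  have hfin : HasDerivAt Gamma (Gamma s * (∑' n, g' n s)) s := by
    have := (hG.cexp.const_mul (Gamma s))
    have hg0 : ∑' n, g n s = 0 := by simp [hg]
    rw [hg0, exp_zero, one_mul] at this
    exact this.congr_of_eventuallyEq
      (eventually_of_mem (hto.mem_nhds hst) hGamma)
  rwa [hfin.deriv, mul_div_cancel_left₀ _ (Gamma_ne_zero (hne s hst))]

lemma norm_log_add_one_sub_log_sub_inv_le {w : ℂ} (hw : 1 ≤ w.im) :
    ‖log (w + 1) - log w - 1 / w‖ ≤ 2 / ‖w‖ ^ 2 := by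
  have him : ∀ t : ℝ, (w + t).im = w.im := fun t ↦ by simp
  have hnorm : ∀ t : ℝ, 1 ≤ ‖w + t‖ := fun t ↦ by
    have := abs_im_le_norm (w + t)
    rw [him] at this
    linarith [le_abs_self w.im]
  have hne : ∀ t : ℝ, w + t ≠ 0 := fun t ↦ norm_pos_iff.mp (by linarith [hnorm t])
  have hw0 : w ≠ 0 := by simpa using hne 0
  have hw1 : 0 < ‖w‖ := norm_pos_iff.mpr hw0
  have key := norm_image_sub_le_of_norm_deriv_le_segment_01'
    (f := fun t : ℝ ↦ log (w + t) - t / w) (f' := fun t : ℝ ↦ 1 / (w + t) - 1 / w)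
    (C := 2 / ‖w‖ ^ 2) ?_ ?_
  · convert! key using 2
    simp; ring
  · intro t _
    apply HasDerivAt.hasDerivWithinAt
    have h1 : HasDerivAt (fun z : ℂ ↦ log (w + z) - z / w) (1 / (w + t) - 1 / w) (t : ℂ) := by
      refine HasDerivAt.sub (((hasDerivAt_id (t : ℂ)).const_add w).clog ?_)
        ((hasDerivAt_id _).div_const w)
      refine mem_slitPlane_iff.mpr (.inr ?_)
      simp only [id, him]
      linarith
    exact h1.comp_ofReal
  · intro t ht
    have h1 : 1 / (w + t) - 1 / w = -t / (w * (w + t)) := by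
      have := hne t
      field_simp; ring
    have h2 : ‖w‖ ≤ 2 * ‖w + t‖ := by
      have h3 := norm_sub_le (w + t) t
      rw [add_sub_cancel_right, Complex.norm_real, Real.norm_eq_abs, abs_of_nonneg ht.1] at h3
      linarith [hnorm t, ht.2]
    rw [h1, norm_div, norm_mul, norm_neg, Complex.norm_real, Real.norm_eq_abs,
      abs_of_nonneg ht.1, div_le_div_iff₀ (by have := hnorm t; positivity) (by positivity)]
    have := ht.2
    calc t * ‖w‖ ^ 2 ≤ 1 * ‖w‖ ^ 2 := by gcongr
      _ = ‖w‖ * ‖w‖ := by ring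
      _ ≤ ‖w‖ * (2 * ‖w + t‖) := by gcongr
      _ = _ := by ring

lemma sum_range_inv_add_sq_le (x : ℝ) (n : ℕ) :
    ∑ j ∈ range n, 1 / (1 + (x + j) ^ 2) ≤ 3 * Real.pi := by
  have step : ∀ y : ℝ, 1 / (1 + y ^ 2) ≤ 3 * (Real.arctan (y + 1) - Real.arctan y) := fun y ↦ by
    obtain ⟨c, hc, hc'⟩ := exists_hasDerivAt_eq_slope Real.arctan (fun z ↦ 1 / (1 + z ^ 2))
      (lt_add_one y) Real.continuous_arctan.continuousOn fun z _ ↦ Real.hasDerivAt_arctan z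
    rw [add_sub_cancel_left, div_one] at hc'
    rw [← hc', mul_one_div, div_le_div_iff₀ (by positivity) (by positivity)]
    nlinarith [hc.1, hc.2, sq_nonneg (y + 1), sq_nonneg (c - y), sq_nonneg (y - 1), sq_nonneg c]
  have tele : ∀ m : ℕ, ∑ j ∈ range m, 1 / (1 + (x + j) ^ 2) ≤
      3 * (Real.arctan (x + m) - Real.arctan x) := fun m ↦ by
    induction m with
    | zero => simp
    | succ m ih =>
      rw [sum_range_succ]
      have := step (x + m)
      push_cast
      rw [← add_assoc]
      linarith
  have h1 := Real.arctan_lt_pi_div_two (x + n)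
  have h2 := Real.neg_pi_div_two_lt_arctan x
  linarith [tele n]

open Filter Topology in
lemma norm_logDeriv_Gamma_sub_log_le {s : ℂ} (hs : 1 ≤ s.im) :
    ‖deriv Gamma s / Gamma s - log s‖ ≤ 7 * Real.pi + 1 := by
  have hlim := (tendsto_log_sub_sum_inv_logDeriv_Gamma (s := s) (by linarith)).sub_const (log s)
  refine le_of_tendsto hlim.norm ?_
  have hlim2 : Tendsto (fun n : ℕ ↦ ‖s + n + 1‖ / n) atTop (𝓝 1) := by
    have h1 : Tendsto (fun n : ℕ ↦ ‖(s + 1) / n + 1‖) atTop (𝓝 ‖(0 : ℂ) + 1‖) :=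
      ((tendsto_const_div_atTop_nhds_zero_nat (s + 1)).add_const 1).norm
    rw [zero_add, norm_one] at h1
    refine h1.congr' ?_
    filter_upwards [eventually_gt_atTop 0] with n hn
    have hn0 : (n : ℂ) ≠ 0 := by exact_mod_cast hn.ne'
    rw [show (s + 1) / n + 1 = (s + n + 1) / n by field_simp; ring, norm_div,
      Complex.norm_natCast]
  have hlim3 := ((Real.continuousAt_log one_ne_zero).tendsto.comp hlim2)
  rw [Real.log_one] at hlim3
  filter_upwards [eventually_gt_atTop 0, hlim3.norm.eventually_le_const (by simp : ‖(0 : ℝ)‖ < 1)]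
    with n hn hn2
  have him : ∀ j : ℕ, 1 ≤ (s + j).im := fun j ↦ by simpa using hs
  have htel : ∑ j ∈ range (n + 1), (log (s + j + 1) - log (s + j)) = log (s + n + 1) - log s := by
    have := sum_range_sub (fun j : ℕ ↦ log (s + j)) (n + 1)
    push_cast at this
    simpa [add_assoc] using this
  have hsplit : (Real.log n : ℂ) - ∑ j ∈ range (n + 1), 1 / (s + j) - log s =
      (Real.log n - log (s + n + 1)) +
        ∑ j ∈ range (n + 1), (log (s + j + 1) - log (s + j) - 1 / (s + j)) := by
    rw [sum_sub_distrib (g := fun j : ℕ ↦ 1 / (s + (j : ℂ))), htel]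
    ring
  rw [hsplit]
  have hA : ‖(Real.log n : ℂ) - log (s + n + 1)‖ ≤ 1 + Real.pi := by
    have hpos : 0 < ‖s + n + 1‖ := by
      refine norm_pos_iff.mpr fun h ↦ ?_
      have := congrArg im h
      simp at this
      linarith
    have hn' : (0 : ℝ) < n := by exact_mod_cast hn
    refine (norm_le_abs_re_add_abs_im _).trans (add_le_add ?_ ?_)
    · simp only [Function.comp_apply, Real.norm_eq_abs] at hn2
      rw [Real.log_div hpos.ne' hn'.ne'] at hn2
      rw [sub_re, ofReal_re, log_re, abs_sub_comm]
      exact hn2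
    · rw [sub_im, ofReal_im, log_im, zero_sub, abs_neg]
      exact abs_arg_le_pi _
  have hB : ‖∑ j ∈ range (n + 1), (log (s + j + 1) - log (s + j) - 1 / (s + j))‖ ≤
      6 * Real.pi := by
    calc _ ≤ ∑ j ∈ range (n + 1), 2 * (1 / (1 + (s.re + j) ^ 2)) := by
          refine norm_sum_le_of_le _ fun j _ ↦
            (norm_log_add_one_sub_log_sub_inv_le (him j)).trans ?_
          rw [mul_one_div]
          have : ‖s + j‖ ^ 2 = (s.re + j) ^ 2 + s.im ^ 2 := by
            rw [Complex.sq_norm, normSq_apply]; simp; ring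
          rw [this]
          exact div_le_div_of_nonneg_left zero_le_two (by positivity) (by nlinarith)
      _ ≤ _ := by
          rw [← mul_sum]
          linarith [sum_range_inv_add_sq_le s.re (n + 1)]
  linarith [norm_add_le ((Real.log n : ℂ) - log (s + n + 1))
    (∑ j ∈ range (n + 1), (log (s + j + 1) - log (s + j) - 1 / (s + j)))]

lemma norm_tan_le_two {z : ℂ} (hz : 1 ≤ z.im) : ‖tan z‖ ≤ 2 := by
  have h1 : ‖exp (z * I)‖ ≤ Real.exp (-1) := by
    rw [norm_exp]; simpa using hz
  have h2 : Real.exp 1 ≤ ‖exp (-z * I)‖ := by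
    rw [norm_exp]; simpa using hz
  have e1 : 2.7 < Real.exp 1 := by linarith [Real.exp_one_gt_d9]
  have e2 : Real.exp (-1) ≤ 0.5 := by
    rw [Real.exp_neg, inv_le_comm₀ (by positivity) (by norm_num)]; linarith
  have hc : cos z ≠ 0 := fun h ↦ by
    have h3 : exp (z * I) + exp (-z * I) = 0 := by
      rw [Complex.cos] at h; simpa using h
    rw [eq_neg_of_add_eq_zero_left h3, norm_neg] at h1
    linarith
  have h4 : ‖sin z‖ ≤ 2 * ‖cos z‖ := by
    rw [Complex.sin, Complex.cos, norm_div, norm_div, norm_mul, norm_I, norm_ofNat]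
    have := norm_sub_le (exp (-z * I)) (exp (z * I))
    have := norm_sub_le (exp (z * I) + exp (-z * I)) (exp (z * I))
    rw [add_sub_cancel_left] at this
    linarith
  rw [Complex.tan, norm_div]
  exact div_le_of_le_mul₀ (norm_nonneg _) zero_le_two h4

lemma exists_norm_omega_sub_log_le :
    ∃ C : ℝ, 0 < C ∧ ∀ s : ℂ, 1 ≤ s.im → ‖omega s - log s‖ ≤ C := by
  refine ⟨|Real.log (2 * Real.pi)| + (7 * Real.pi + 1) + Real.pi, by positivity, fun s hs ↦ ?_⟩
  have h1 : ‖(Real.log (2 * Real.pi) : ℂ)‖ = |Real.log (2 * Real.pi)| := by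
    rw [Complex.norm_real, Real.norm_eq_abs]
  have h2 := norm_logDeriv_Gamma_sub_log_le hs
  have h3 : ‖(Real.pi / 2 : ℂ) * tan (Real.pi * s / 2)‖ ≤ Real.pi := by
    rw [show (Real.pi / 2 : ℂ) = ((Real.pi / 2 : ℝ) : ℂ) by push_cast; rfl, norm_mul,
      Complex.norm_real, Real.norm_eq_abs, abs_of_pos (by positivity)]
    have : 1 ≤ ((Real.pi : ℂ) * s / 2).im := by
      rw [show (Real.pi : ℂ) * s / 2 = ((Real.pi / 2 : ℝ) : ℂ) * s by push_cast; ring, im_ofReal_mul]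
      nlinarith [Real.pi_gt_three]
    nlinarith [norm_tan_le_two this, Real.pi_pos]
  rw [omega, show ∀ a b c d : ℂ, a + b - c - d = a + (b - d) - c by intros; ring]
  refine (norm_sub_le _ _).trans (add_le_add ((norm_add_le _ _).trans (add_le_add h1.le h2)) h3)

lemma differentiableAt_Gamma_of_im_pos {s : ℂ} (hs : 0 < s.im) : DifferentiableAt ℂ Gamma s :=
  differentiableAt_Gamma s fun m h ↦ by simp [h] at hs

lemma Gamma_ne_zero_of_im_pos {s : ℂ} (hs : 0 < s.im) : Gamma s ≠ 0 :=
  Gamma_ne_zero fun m h ↦ by simp [h] at hs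

lemma cos_ne_zero_of_im_pos {z : ℂ} (hz : 0 < z.im) : cos z ≠ 0 := fun h ↦ by
  obtain ⟨k, hk⟩ := Complex.cos_eq_zero_iff.mp h
  rw [hk, show ((2 * k + 1) * Real.pi / 2 : ℂ) = (((2 * k + 1) * Real.pi / 2 : ℝ) : ℂ) by
    push_cast; rfl, ofReal_im] at hz
  exact hz.false

lemma im_pi_mul_div_two_pos {s : ℂ} (hs : 0 < s.im) : 0 < ((Real.pi : ℂ) * s / 2).im := by
  rw [show (Real.pi : ℂ) * s / 2 = ((Real.pi / 2 : ℝ) : ℂ) * s by push_cast; ring, im_ofReal_mul]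
  positivity

lemma isOpen_im_pos : IsOpen {s : ℂ | 0 < s.im} := isOpen_lt continuous_const continuous_im

lemma differentiableOn_omega : DifferentiableOn ℂ omega {s | 0 < s.im} := by
  intro s hs
  refine DifferentiableAt.differentiableWithinAt ?_
  unfold omega
  have hG : DifferentiableOn ℂ Gamma {s | 0 < s.im} := fun z hz ↦
    (differentiableAt_Gamma_of_im_pos hz).differentiableWithinAt
  have h1 := (hG.deriv isOpen_im_pos).differentiableAt (isOpen_im_pos.mem_nhds hs)
  have h2 : DifferentiableAt ℂ (fun s : ℂ ↦ tan (Real.pi * s / 2)) s :=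
    DifferentiableAt.comp s
      (differentiableAt_tan.mpr (cos_ne_zero_of_im_pos (im_pi_mul_div_two_pos hs))) (by fun_prop)
  exact ((h1.div (differentiableAt_Gamma_of_im_pos hs)
    (Gamma_ne_zero_of_im_pos hs)).const_add _).sub (h2.const_mul _)

section ZetaBound

open MeasureTheory Set Asymptotics Filter

/-- The fractional part, cut off to the half-line `(1, ∞)`. -/
noncomputable def fractIoi (t : ℝ) : ℂ := (Ioi (1 : ℝ)).indicator (fun t ↦ ((Int.fract t : ℝ) : ℂ)) t

lemma norm_fractIoi_le (t : ℝ) : ‖fractIoi t‖ ≤ 1 := by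
  refine (norm_indicator_le_norm_self _ _).trans ?_
  rw [Complex.norm_real, Real.norm_eq_abs, abs_of_nonneg (Int.fract_nonneg t)]
  exact (Int.fract_lt_one t).le

lemma measurable_fractIoi : Measurable fractIoi :=
  (measurable_ofReal.comp measurable_fract).indicator measurableSet_Ioi

lemma differentiableAt_mellin_fractIoi {s : ℂ} (hs : s.re < 0) :
    DifferentiableAt ℂ (mellin fractIoi) s := by
  refine mellin_differentiableAt_of_isBigO_rpow (a := 0) (b := s.re - 1) ?_ ?_ hs ?_ (by linarith)
  · refine LocallyIntegrable.locallyIntegrableOn ?_ _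
    exact (locallyIntegrable_const (1 : ℝ)).mono measurable_fractIoi.aestronglyMeasurable
      (.of_forall fun t ↦ by simpa using norm_fractIoi_le t)
  · refine isBigO_of_le _ fun t ↦ ?_
    simpa using norm_fractIoi_le t
  · refine (isBigO_zero _ _).congr' ?_ .rfl
    filter_upwards [nhdsWithin_le_nhds (Iio_mem_nhds zero_lt_one)] with t ht
    simp only [fractIoi]
    rw [indicator_of_notMem (by simpa using ht.le)]

lemma mellin_fractIoi (s : ℂ) :
    mellin fractIoi s = ∫ t in Ioi (1 : ℝ), (t : ℂ) ^ (s - 1) * ((Int.fract t : ℝ) : ℂ) := by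
  have h (t : ℝ) : (t : ℂ) ^ (s - 1) • fractIoi t =
      (Ioi (1 : ℝ)).indicator (fun t ↦ (t : ℂ) ^ (s - 1) * ((Int.fract t : ℝ) : ℂ)) t := by
    simp only [fractIoi, indicator, smul_eq_mul]
    split_ifs <;> simp
  simp only [mellin, h]
  rw [setIntegral_indicator measurableSet_Ioi,
    inter_eq_self_of_subset_right (Set.Ioi_subset_Ioi zero_le_one)]

lemma norm_mellin_fractIoi_le {s : ℂ} (hs : s.re < 0) :
    ‖mellin fractIoi s‖ ≤ 1 / -s.re := by
  rw [mellin_fractIoi]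
  have h : ∫ t in Ioi (1 : ℝ), t ^ (s.re - 1) = 1 / -s.re := by
    rw [integral_Ioi_rpow_of_lt (by linarith) one_pos]
    simp [div_neg, neg_div]
  rw [← h]
  refine norm_integral_le_of_norm_le (integrableOn_Ioi_rpow_of_lt (by linarith) one_pos) ?_
  filter_upwards [ae_restrict_mem measurableSet_Ioi] with t ht
  have ht0 : 0 < t := one_pos.trans ht
  rw [norm_mul, norm_cpow_eq_rpow_re_of_pos ht0, Complex.norm_real, Real.norm_eq_abs,
    abs_of_nonneg (Int.fract_nonneg t), sub_re, one_re]
  exact mul_le_of_le_one_right (by positivity) (Int.fract_lt_one t).le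

lemma riemannZeta_eq_sub_mellin_of_one_lt_re {s : ℂ} (hs : 1 < s.re) :
    riemannZeta s = s / (s - 1) - s * mellin fractIoi (-s) := by
  have h1 : LSeries 1 s = s * ∫ t in Ioi (1 : ℝ), (∑ k ∈ Finset.Icc 1 ⌊t⌋₊, (1 : ℕ → ℂ) k) *
      (t : ℂ) ^ (-(s + 1)) := by
    refine LSeries_eq_mul_integral (r := 1) 1 zero_le_one hs (LSeriesSummable_one_iff.mpr hs) ?_
    refine isBigO_of_le _ fun n ↦ ?_
    simp
  have hi1 : IntegrableOn (fun t : ℝ ↦ (t : ℂ) ^ (-s)) (Ioi 1) :=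
    integrableOn_Ioi_cpow_of_lt (by simpa using hs) one_pos
  have hi2 : IntegrableOn (fun t : ℝ ↦ (t : ℂ) ^ (-s - 1) * ((Int.fract t : ℝ) : ℂ)) (Ioi 1) := by
    have hi : IntegrableOn (fun t : ℝ ↦ (t : ℂ) ^ (-s - 1)) (Ioi 1) :=
      integrableOn_Ioi_cpow_of_lt (by simp; linarith) one_pos
    refine hi.mul_bdd (c := 1) (measurable_ofReal.comp measurable_fract).aestronglyMeasurable ?_
    refine .of_forall fun t ↦ ?_
    rw [Complex.norm_real, Real.norm_eq_abs, abs_of_nonneg (Int.fract_nonneg t)]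
    exact (Int.fract_lt_one t).le
  rw [← LSeries_one_eq_riemannZeta hs, h1, mellin_fractIoi]
  have h2 : ∫ t in Ioi (1 : ℝ), (∑ k ∈ Finset.Icc 1 ⌊t⌋₊, (1 : ℕ → ℂ) k) * (t : ℂ) ^ (-(s + 1)) =
      ∫ t in Ioi (1 : ℝ), ((t : ℂ) ^ (-s) - (t : ℂ) ^ (-s - 1) * ((Int.fract t : ℝ) : ℂ)) := by
    refine setIntegral_congr_fun measurableSet_Ioi fun t ht ↦ ?_
    have ht0 : 0 < t := one_pos.trans ht
    have ht' : (t : ℂ) ≠ 0 := by exact_mod_cast ht0.ne'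
    have h3 : (∑ k ∈ Finset.Icc 1 ⌊t⌋₊, (1 : ℕ → ℂ) k) = t - ((Int.fract t : ℝ) : ℂ) := by
      simp only [Pi.one_apply, Finset.sum_const, Nat.card_Icc, add_tsub_cancel_right, nsmul_eq_mul,
        mul_one]
      rw [← Int.self_sub_floor, ← natCast_floor_eq_intCast_floor ht0.le]
      push_cast
      ring
    have h4 : (t : ℂ) ^ (-s) = t ^ (-s - 1) * t := by
      rw [cpow_sub _ _ ht', cpow_one, div_mul_cancel₀ _ ht']
    simp only [h3, h4]
    rw [show -(s + 1) = -s - 1 by ring]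
    ring
  rw [h2, integral_sub hi1 hi2, integral_Ioi_cpow_of_lt (by simpa using hs) one_pos]
  have hs1 : s - 1 ≠ 0 := fun h ↦ by
    have := congrArg re h
    simp at this
    linarith
  have hs2 : -s + 1 ≠ 0 := fun h ↦ hs1 (by linear_combination -h)
  rw [ofReal_one, one_cpow, mul_sub]
  congr 1
  rw [neg_div, ← div_neg, mul_one_div]
  ring_nf

lemma riemannZeta_eq_sub_mellin {s : ℂ} (hs : 0 < s.re) (hs' : 0 < s.im) :
    riemannZeta s = s / (s - 1) - s * mellin fractIoi (-s) := by
  set U : Set ℂ := {z | 0 < z.re} ∩ {z | 0 < z.im}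
  have hU : IsOpen U := (isOpen_lt continuous_const continuous_re).inter isOpen_im_pos
  have hUc : IsPreconnected U :=
    ((convex_halfSpace_re_gt _).inter (convex_halfSpace_im_gt _)).isPreconnected
  have hne : ∀ z ∈ U, z ≠ 1 := fun z hz h ↦ by
    have := hz.2
    simp [h] at this
  have hf : DifferentiableOn ℂ riemannZeta U := fun z hz ↦
    (differentiableAt_riemannZeta (hne z hz)).differentiableWithinAt
  have hg : DifferentiableOn ℂ (fun s ↦ s / (s - 1) - s * mellin fractIoi (-s)) U := fun z hz ↦ by
    refine DifferentiableAt.differentiableWithinAt ?_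
    have h1 : DifferentiableAt ℂ (fun s ↦ mellin fractIoi (-s)) z :=
      
      DifferentiableAt.comp (g := mellin fractIoi) z
        (differentiableAt_mellin_fractIoi (by simpa using hz.1)) (by fun_prop)
    have h2 : z - 1 ≠ 0 := sub_ne_zero.mpr (hne z hz)
    fun_prop (disch := assumption)
  refine (hf.analyticOnNhd hU).eqOn_of_preconnected_of_eventuallyEq (hg.analyticOnNhd hU) hUc
    (z₀ := 2 + I) (by constructor <;> simp) ?_ ⟨hs, hs'⟩
  have : {z : ℂ | 1 < z.re} ∈ nhds (2 + I) :=
    (isOpen_lt continuous_const continuous_re).mem_nhds (by simp)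
  filter_upwards [this] with z hz using riemannZeta_eq_sub_mellin_of_one_lt_re hz

lemma norm_riemannZeta_le_of_im_pos {s : ℂ} (hs : 1 / 2 ≤ s.re) (hs' : 1 ≤ s.im) :
    ‖riemannZeta s‖ ≤ 3 * ‖s‖ := by
  rw [riemannZeta_eq_sub_mellin (by linarith) (by linarith)]
  have h1 : ‖mellin fractIoi (-s)‖ ≤ 2 := by
    refine (norm_mellin_fractIoi_le (by simp; linarith)).trans ?_
    rw [neg_re, neg_neg, div_le_iff₀ (by linarith)]
    linarith
  have h2 : 1 ≤ ‖s - 1‖ := by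
    have := abs_im_le_norm (s - 1)
    simp only [sub_im, one_im, sub_zero] at this
    linarith [le_abs_self s.im]
  calc _ ≤ ‖s / (s - 1)‖ + ‖s * mellin fractIoi (-s)‖ := norm_sub_le _ _
    _ ≤ ‖s‖ + ‖s‖ * 2 := by
      rw [norm_div, norm_mul]
      gcongr
      exact div_le_self (norm_nonneg _) h2
    _ = _ := by ring

lemma norm_riemannZeta_le {s : ℂ} (hs : 1 / 2 ≤ s.re) (hs' : 1 ≤ |s.im|) :
    ‖riemannZeta s‖ ≤ 3 * ‖s‖ := by
  rcases le_abs'.mp hs' with h | h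
  · have := norm_riemannZeta_le_of_im_pos (s := (starRingEnd ℂ) s) (by simpa using hs)
      (by rw [conj_im]; linarith)
    rwa [riemannZeta_conj, norm_conj, norm_conj] at this
  · exact norm_riemannZeta_le_of_im_pos hs h

end ZetaBound

section ThreeCircles

open Metric HadamardThreeLines

lemma norm_le_rpow_mul_rpow_of_three_circles {g : ℂ → ℂ} {c z : ℂ} {R r₁ r₂ ρ m M : ℝ}
    (hg : DifferentiableOn ℂ g (ball c R)) (hr₁ : 0 < r₁) (hr : r₁ < r₂) (hr₂ : r₂ < R)
    (hm : 0 < m) (hmM : m ≤ M) (hgm : ∀ w ∈ closedBall c r₁, ‖g w‖ ≤ m)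
    (hgM : ∀ w ∈ closedBall c r₂, ‖g w‖ ≤ M) (hρ₁ : r₁ ≤ ρ) (hρ₂ : ρ ≤ r₂)
    (hz : z ∈ closedBall c ρ) :
    ‖g z‖ ≤ m ^ (1 - (Real.log ρ - Real.log r₁) / (Real.log r₂ - Real.log r₁)) *
      M ^ ((Real.log ρ - Real.log r₁) / (Real.log r₂ - Real.log r₁)) := by
  have hM : 0 < M := hm.trans_le hmM
  have hlog : Real.log r₁ < Real.log r₂ := Real.log_lt_log hr₁ hr
  have key (x : ℝ) : m ^ (1 - x) * M ^ x = m * (M / m) ^ x := by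
    rw [Real.rpow_sub hm, Real.rpow_one, Real.div_rpow hM.le hm.le]
    ring
  have one_le : 1 ≤ M / m := (one_le_div hm).2 hmM
  have hθ : 0 ≤ (Real.log ρ - Real.log r₁) / (Real.log r₂ - Real.log r₁) :=
    div_nonneg (sub_nonneg.2 (Real.log_le_log hr₁ hρ₁)) (sub_pos.2 hlog).le
  rw [key]
  rcases le_or_gt ‖z - c‖ r₁ with h | h
  · calc ‖g z‖ ≤ m * 1 := by simpa using hgm z (mem_closedBall_iff_norm.2 h)
      _ ≤ _ := by gcongr; exact Real.one_le_rpow one_le hθ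
  · have hpos : 0 < ‖z - c‖ := hr₁.trans h
    have hzc : z - c ≠ 0 := norm_pos_iff.1 hpos
    have hzρ : ‖z - c‖ ≤ ρ := mem_closedBall_iff_norm.1 hz
    have hnorm (w : ℂ) : ‖c + exp w - c‖ = Real.exp w.re := by simp [norm_exp]
    have hle (w : ℂ) (x : ℝ) (hx : 0 < x) (hw : w.re ≤ Real.log x) :
        c + exp w ∈ closedBall c x := by
      rw [mem_closedBall_iff_norm, hnorm]
      exact (Real.exp_le_exp.2 hw).trans (Real.exp_log hx).le
    have hbound := norm_le_interp_of_mem_verticalClosedStrip' (f := fun w ↦ g (c + exp w))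
      (z := log (z - c)) (a := m) (b := M) hlog
      ⟨by rw [log_re]; exact Real.log_le_log hr₁ h.le,
        by rw [log_re]; exact Real.log_le_log hpos (hzρ.trans hρ₂)⟩
      (DifferentiableOn.diffContOnCl fun w hw ↦ by
        have hw' : w ∈ verticalClosedStrip (Real.log r₁) (Real.log r₂) := by
          have hcl : IsClosed (verticalClosedStrip (Real.log r₁) (Real.log r₂)) :=
            isClosed_Icc.preimage continuous_re
          have hsub : verticalStrip (Real.log r₁) (Real.log r₂) ⊆
              verticalClosedStrip (Real.log r₁) (Real.log r₂) :=
            Set.preimage_mono Set.Ioo_subset_Icc_self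
          exact closure_minimal hsub hcl hw
        have := hle w r₂ (hr₁.trans hr) hw'.2
        have hd : DifferentiableAt ℂ g (c + exp w) :=
          hg.differentiableAt (isOpen_ball.mem_nhds (closedBall_subset_ball hr₂ this))
        exact (hd.comp w (by fun_prop : DifferentiableAt ℂ (fun w ↦ c + exp w) w)
          ).differentiableWithinAt)
      ⟨M, by
        rintro _ ⟨w, hw, rfl⟩
        exact hgM _ (hle w r₂ (hr₁.trans hr) hw.2)⟩
      (fun w hw ↦ hgm _ (hle w r₁ hr₁ (le_of_eq hw)))
      (fun w hw ↦ hgM _ (hle w r₂ (hr₁.trans hr) (le_of_eq hw)))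
    rw [key, exp_log hzc, add_sub_cancel, log_re] at hbound
    refine hbound.trans ?_
    gcongr

end ThreeCircles

section LogDerivBound

open Metric Set

lemma exists_exp_eq_div_of_forall_ne_zero {f : ℂ → ℂ} {c : ℂ} {R : ℝ} (hR : 0 < R)
    (hf : DifferentiableOn ℂ f (ball c R)) (hf₀ : ∀ z ∈ ball c R, f z ≠ 0) :
    ∃ L : ℂ → ℂ, L c = 0 ∧ (∀ z ∈ ball c R, HasDerivAt L (deriv f z / f z) z) ∧
      ∀ z ∈ ball c R, exp (L z) = f z / f c := by
  obtain ⟨L, hLc, hL⟩ := (DifferentiableOn.isExactOn_ball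
    ((hf.deriv isOpen_ball).div hf hf₀)).with_val_at c 0
  have hc : c ∈ ball c R := mem_ball_self hR
  refine ⟨L, hLc, hL, fun z hz ↦ ?_⟩
  have hd (w : ℂ) (hw : w ∈ ball c R) :
      HasDerivAt (fun w ↦ f w * exp (-L w)) 0 w := by
    have h := (hf.differentiableAt (isOpen_ball.mem_nhds hw)).hasDerivAt.mul (hL w hw).fun_neg.cexp
    refine h.congr_deriv ?_
    have := hf₀ w hw
    simp only [Pi.div_apply]
    field_simp
    ring
  have hconst := (isOpen_ball (x := c) (ε := R)).is_const_of_deriv_eq_zero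
    (convex_ball c R).isPreconnected
    (fun w hw ↦ (hd w hw).differentiableAt.differentiableWithinAt)
    (fun w hw ↦ (hd w hw).deriv) hz hc
  simp only [hLc, neg_zero, exp_zero, mul_one] at hconst
  rw [eq_div_iff (hf₀ c hc), ← hconst, mul_left_comm, ← exp_add]
  simp

lemma norm_deriv_div_le_of_norm_le_exp_mul {f : ℂ → ℂ} {c z : ℂ} {r R M : ℝ} (hM : 0 < M)
    (hf : DifferentiableOn ℂ f (ball c R)) (hf₀ : ∀ z ∈ ball c R, f z ≠ 0)
    (hfM : ∀ z ∈ ball c R, ‖f z‖ ≤ Real.exp M * ‖f c‖) (hr : 0 ≤ r) (hrR : r < R)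
    (hz : z ∈ closedBall c r) : ‖deriv f z / f z‖ ≤ 8 * M * R / (R - r) ^ 2 := by
  have hR : 0 < R := hr.trans_lt hrR
  obtain ⟨L, hLc, hL, hexp⟩ := exists_exp_eq_div_of_forall_ne_zero hR hf hf₀
  have hfc : 0 < ‖f c‖ := norm_pos_iff.2 (hf₀ c (mem_ball_self hR))
  have hmem (w : ℂ) (hw : w ∈ ball (0 : ℂ) R) : c + w ∈ ball c R := by
    simpa [mem_ball_iff_norm] using hw
  have hLbound (w : ℂ) (hw : ‖w‖ ≤ (R + r) / 2) : ‖L (c + w)‖ ≤ 4 * M * R / (R - r) := by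
    have hwR : ‖w‖ < R := by linarith
    have h := borelCaratheodory_zero (f := fun w ↦ L (c + w)) hM
      (fun v hv ↦ ((hL _ (hmem v hv)).comp_const_add c v).differentiableAt.differentiableWithinAt)
      (fun v hv ↦ by
        have h₁ : Real.exp (L (c + v)).re ≤ Real.exp M := by
          rw [← norm_exp, hexp _ (hmem v hv), norm_div, div_le_iff₀ hfc]
          exact hfM _ (hmem v hv)
        exact Real.exp_le_exp.1 h₁)
      hR (mem_ball_zero_iff.2 hwR) (by simpa using hLc)
    refine h.trans ?_
    calc 2 * M * ‖w‖ / (R - ‖w‖) ≤ 2 * M * R / ((R - r) / 2) := by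
          gcongr
          linarith
      _ = 4 * M * R / (R - r) := by field_simp; ring
  have hδ : 0 < (R - r) / 2 := by linarith
  have hzc : ‖z - c‖ ≤ r := mem_closedBall_iff_norm.1 hz
  have hsub (w : ℂ) (hw : w ∈ closedBall z ((R - r) / 2)) : ‖w - c‖ ≤ (R + r) / 2 := by
    have := norm_add_le (w - z) (z - c)
    rw [sub_add_sub_cancel] at this
    linarith [mem_closedBall_iff_norm.1 hw]
  have hLd (w : ℂ) (hw : w ∈ closedBall z ((R - r) / 2)) : DifferentiableAt ℂ L w :=
    (hL w (mem_ball_iff_norm.2 (by linarith [hsub w hw]))).differentiableAt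
  have h := norm_deriv_le_of_forall_mem_sphere_norm_le (f := L) (c := z) hδ
    (DifferentiableOn.diffContOnCl_ball (U := closedBall z ((R - r) / 2))
      (fun w hw ↦ (hLd w hw).differentiableWithinAt) le_rfl)
    (C := 4 * M * R / (R - r))
    (fun w hw ↦ by simpa using hLbound (w - c) (hsub w (sphere_subset_closedBall hw)))
  rw [(hL z (mem_ball_iff_norm.2 (by linarith))).deriv] at h
  refine h.trans_eq ?_
  have : R - r ≠ 0 := by linarith
  field_simp
  ring

end LogDerivBound

section RightHalfPlane

open Metric Filter Topology ArithmeticFunction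

lemma exists_norm_LSeries_le {f : ℕ → ℂ} (hf : LSeriesSummable f 2) :
    ∃ C : ℝ, 0 < C ∧ ∀ s : ℂ, 2 ≤ s.re → ‖LSeries f s‖ ≤ C := by
  refine ⟨∑' n, ‖LSeries.term f 2 n‖ + 1, by positivity, fun s hs ↦ ?_⟩
  have hle (n : ℕ) : ‖LSeries.term f s n‖ ≤ ‖LSeries.term f 2 n‖ :=
    LSeries.norm_term_le_of_re_le_re f (by simpa using hs) n
  have hs' : Summable fun n ↦ ‖LSeries.term f s n‖ :=
    Summable.of_nonneg_of_le (fun _ ↦ norm_nonneg _) hle hf.norm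
  calc ‖LSeries f s‖ ≤ ∑' n, ‖LSeries.term f s n‖ := norm_tsum_le_tsum_norm hs'
    _ ≤ ∑' n, ‖LSeries.term f 2 n‖ := hs'.tsum_le_tsum hle hf.norm
    _ ≤ _ := by linarith

lemma exists_norm_logDeriv_zeta_le_of_two_le_re :
    ∃ C : ℝ, 0 < C ∧ ∀ s : ℂ, 2 ≤ s.re → ‖deriv riemannZeta s / riemannZeta s‖ ≤ C := by
  obtain ⟨C, hC, h⟩ := exists_norm_LSeries_le (LSeriesSummable_vonMangoldt (s := 2) (by norm_num))
  refine ⟨C, hC, fun s hs ↦ ?_⟩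
  have := h s hs
  rwa [LSeries_vonMangoldt_eq_deriv_riemannZeta_div (by linarith), neg_div, norm_neg] at this

lemma exists_one_le_mul_norm_riemannZeta :
    ∃ K : ℝ, 1 ≤ K ∧ ∀ s : ℂ, 2 ≤ s.re → 1 ≤ K * ‖riemannZeta s‖ := by
  obtain ⟨C, hC, h⟩ := exists_norm_LSeries_le
    (LSeriesSummable_moebius_iff.2 (by norm_num : 1 < (2 : ℂ).re))
  refine ⟨max C 1, le_max_right _ _, fun s hs ↦ ?_⟩
  have hs₁ : 1 < s.re := by linarith
  have hmul := LSeries_zeta_mul_Lseries_moebius hs₁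
  rw [LSeries_zeta_eq_riemannZeta hs₁] at hmul
  calc (1 : ℝ) = ‖riemannZeta s‖ * ‖LSeries (fun n ↦ (moebius n : ℂ)) s‖ := by
        rw [← norm_mul, hmul, norm_one]
    _ ≤ ‖riemannZeta s‖ * max C 1 := by gcongr; exact (h s hs).trans (le_max_left _ _)
    _ = _ := mul_comm _ _

lemma RiemannHypothesis.riemannZeta_ne_zero (hRH : RiemannHypothesis) {s : ℂ}
    (hs : 1 / 2 < s.re) (hs' : s ≠ 1) : riemannZeta s ≠ 0 := fun h ↦ by
  have := hRH s h ?_ hs'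
  · linarith
  · rintro ⟨n, hn⟩
    rw [hn] at hs
    have : (-2 * ((n : ℂ) + 1)).re = -2 * ((n : ℝ) + 1) := by simp
    rw [this] at hs
    have : (0 : ℝ) ≤ n := n.cast_nonneg
    linarith

lemma RiemannHypothesis.norm_logDeriv_zeta_le_log (hRH : RiemannHypothesis) {r : ℝ}
    (hr₀ : 0 ≤ r) (hr : r < 5 / 2) :
    ∃ B : ℝ, 1 ≤ B ∧ ∀ t : ℝ, 6 ≤ |t| → ∀ z ∈ closedBall (3 + t * I : ℂ) r,
      ‖deriv riemannZeta z / riemannZeta z‖ ≤ B * Real.log |t| := by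
  obtain ⟨K, hK, hζ⟩ := exists_one_le_mul_norm_riemannZeta
  have hlogK : 0 ≤ Real.log (6 * K) := Real.log_nonneg (by linarith)
  refine ⟨max 1 (8 * (Real.log (6 * K) + 1) * (5 / 2) / (5 / 2 - r) ^ 2), le_max_left _ _,
    fun t ht z hz ↦ ?_⟩
  have ht₀ : 0 < |t| := by linarith
  have hlog : 1 ≤ Real.log |t| := by
    rw [Real.le_log_iff_exp_le ht₀]
    linarith [Real.exp_one_lt_d9]
  have hM : 0 < Real.log (6 * K * |t|) := Real.log_pos (by nlinarith)
  have hre (w : ℂ) (hw : w ∈ ball (3 + t * I : ℂ) (5 / 2)) : 1 / 2 < w.re := by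
    have := (abs_re_le_norm _).trans_lt (mem_ball_iff_norm.1 hw)
    simp only [sub_re, add_re, re_ofNat, mul_re, ofReal_re, I_re, mul_zero, ofReal_im, I_im,
      mul_one, sub_self, add_zero] at this
    linarith [(abs_lt.1 this).1]
  have him (w : ℂ) (hw : w ∈ ball (3 + t * I : ℂ) (5 / 2)) : 1 ≤ |w.im| := by
    have := (abs_im_le_norm _).trans_lt (mem_ball_iff_norm.1 hw)
    simp only [sub_im, add_im, im_ofNat, mul_im, ofReal_re, I_im, mul_one, ofReal_im, I_re,
      mul_zero, add_zero, zero_add] at this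
    linarith [abs_sub_abs_le_abs_sub t w.im, abs_sub_comm t w.im]
  have hne (w : ℂ) (hw : w ∈ ball (3 + t * I : ℂ) (5 / 2)) : w ≠ 1 := by
    rintro rfl
    have := him 1 hw
    norm_num at this
  have hnorm (w : ℂ) (hw : w ∈ ball (3 + t * I : ℂ) (5 / 2)) : ‖w‖ ≤ 2 * |t| := by
    have h₁ := norm_add_le (w - (3 + t * I)) (3 + t * I)
    have h₂ := norm_add_le (3 : ℂ) (t * I)
    rw [sub_add_cancel] at h₁
    simp only [norm_ofNat, norm_mul, norm_real, Real.norm_eq_abs, norm_I, mul_one] at h₂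
    linarith [mem_ball_iff_norm.1 hw]
  have h := norm_deriv_div_le_of_norm_le_exp_mul (f := riemannZeta) hM
    (fun w hw ↦ (differentiableAt_riemannZeta (hne w hw)).differentiableWithinAt)
    (fun w hw ↦ hRH.riemannZeta_ne_zero (hre w hw) (hne w hw))
    (fun w hw ↦ by
      rw [Real.exp_log (by positivity)]
      calc ‖riemannZeta w‖ ≤ 3 * ‖w‖ := norm_riemannZeta_le (hre w hw).le (him w hw)
        _ ≤ 6 * |t| * 1 := by linarith [hnorm w hw]
        _ ≤ 6 * |t| * (K * ‖riemannZeta (3 + t * I)‖) := by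
            gcongr
            exact hζ _ (by simp; norm_num)
        _ = _ := by ring)
    hr₀ hr hz
  refine h.trans ?_
  rw [Real.log_mul (by positivity) ht₀.ne']
  calc 8 * (Real.log (6 * K) + Real.log |t|) * (5 / 2) / (5 / 2 - r) ^ 2
      ≤ 8 * ((Real.log (6 * K) + 1) * Real.log |t|) * (5 / 2) / (5 / 2 - r) ^ 2 := by
        gcongr
        nlinarith
    _ = 8 * (Real.log (6 * K) + 1) * (5 / 2) / (5 / 2 - r) ^ 2 * Real.log |t| := by ring
    _ ≤ _ := by gcongr; exact le_max_right _ _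

lemma RiemannHypothesis.exists_norm_logDeriv_zeta_le (hRH : RiemannHypothesis) {a ε : ℝ}
    (ha : 1 / 2 < a) (hε : 0 < ε) :
    ∃ T : ℝ, 6 ≤ T ∧ ∀ s : ℂ, a ≤ s.re → T ≤ |s.im| →
      ‖deriv riemannZeta s / riemannZeta s‖ ≤ ε * Real.log ‖s‖ := by
  wlog ha₁ : a ≤ 1 generalizing a
  · obtain ⟨T, hT, h⟩ := this (a := 1) (by norm_num) le_rfl
    exact ⟨T, hT, fun s hs ↦ h s (by linarith)⟩
  obtain ⟨m, hm, hζm⟩ := exists_norm_logDeriv_zeta_le_of_two_le_re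
  obtain ⟨B, hB, hζB⟩ := hRH.norm_logDeriv_zeta_le_log (r := 3 - (a + 1 / 2) / 2)
    (by linarith) (by linarith)
  set θ : ℝ := (Real.log (3 - a) - Real.log 1) / (Real.log (3 - (a + 1 / 2) / 2) - Real.log 1)
    with hθ
  have hθ₁ : θ < 1 := by
    rw [hθ, Real.log_one, sub_zero, sub_zero,
      div_lt_one (Real.log_pos (by linarith))]
    exact Real.log_lt_log (by linarith) (by linarith)
  have hlim : Tendsto (fun t ↦ m ^ (1 - θ) * B ^ θ * (Real.log t) ^ (-(1 - θ))) atTop (𝓝 0) := by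
    simpa using ((tendsto_rpow_neg_atTop (sub_pos.2 hθ₁)).comp
      Real.tendsto_log_atTop).const_mul (m ^ (1 - θ) * B ^ θ)
  obtain ⟨T, hT⟩ := eventually_atTop.1 ((hlim.eventually_le_const hε).and
    ((Real.tendsto_log_atTop.eventually_ge_atTop (m + m / ε)).and (eventually_ge_atTop 6)))
  refine ⟨max T 6, le_max_right _ _, fun s hs hst ↦ ?_⟩
  obtain ⟨h₁, h₂, h₆⟩ := hT |s.im| ((le_max_left _ _).trans hst)
  have hlogpos : 0 < Real.log |s.im| := Real.log_pos (by linarith)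
  have hmε : 0 < m / ε := by positivity
  have hlog : Real.log |s.im| ≤ Real.log ‖s‖ :=
    Real.log_le_log (by linarith) (abs_im_le_norm s)
  refine le_trans ?_ (mul_le_mul_of_nonneg_left hlog hε.le)
  rcases le_total 2 s.re with hre | hre
  · refine (hζm s hre).trans ?_
    rw [← div_le_iff₀' hε]
    linarith
  have hball : DifferentiableOn ℂ (fun z ↦ deriv riemannZeta z / riemannZeta z)
      (ball (3 + s.im * I : ℂ) (5 / 2)) := by
    intro z hz
    have hz₁ : z ≠ 1 := by
      rintro rfl
      have := (abs_im_le_norm _).trans_lt (mem_ball_iff_norm.1 hz)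
      simp at this
      linarith
    have hz₂ : 1 / 2 < z.re := by
      have := (abs_re_le_norm _).trans_lt (mem_ball_iff_norm.1 hz)
      simp only [sub_re, add_re, re_ofNat, mul_re, ofReal_re, I_re, mul_zero, ofReal_im, I_im,
        mul_one, sub_self, add_zero] at this
      linarith [(abs_lt.1 this).1]
    have hd : DifferentiableOn ℂ riemannZeta {1}ᶜ := fun w hw ↦
      (differentiableAt_riemannZeta hw).differentiableWithinAt
    have hmem := isOpen_compl_singleton.mem_nhds (show z ∈ ({1} : Set ℂ)ᶜ from hz₁)
    exact (((hd.deriv isOpen_compl_singleton).differentiableAt hmem).div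
      (hd.differentiableAt hmem) (hRH.riemannZeta_ne_zero hz₂ hz₁)).differentiableWithinAt
  have hmain := norm_le_rpow_mul_rpow_of_three_circles (z := s) (r₁ := 1) (ρ := 3 - a)
    (r₂ := 3 - (a + 1 / 2) / 2) (m := m) (M := B * Real.log |s.im|) hball one_pos (by linarith)
    (by linarith) hm (by nlinarith)
    (fun w hw ↦ hζm w (by
      have := (abs_re_le_norm _).trans (mem_closedBall_iff_norm.1 hw)
      simp only [sub_re, add_re, re_ofNat, mul_re, ofReal_re, I_re, mul_zero, ofReal_im, I_im,
        mul_one, sub_self, add_zero] at this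
      linarith [(abs_le.1 this).1]))
    (hζB s.im h₆) (by linarith) (by linarith)
    (by
      rw [mem_closedBall_iff_norm]
      have : s - (3 + s.im * I) = ((s.re - 3 : ℝ) : ℂ) := by
        apply Complex.ext <;> simp
      rw [this, norm_real, Real.norm_eq_abs, abs_le]
      constructor <;> linarith)
  rw [← hθ] at hmain
  refine hmain.trans ?_
  rw [Real.mul_rpow (by linarith) hlogpos.le, ← mul_assoc]
  calc m ^ (1 - θ) * B ^ θ * Real.log |s.im| ^ θ
      = m ^ (1 - θ) * B ^ θ * Real.log |s.im| ^ (-(1 - θ)) * Real.log |s.im| := by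
        rw [mul_assoc _ _ (Real.log |s.im|), ← Real.rpow_add_one hlogpos.ne']
        ring_nf
    _ ≤ ε * Real.log |s.im| := by gcongr

end RightHalfPlane

section Omega

open Metric Filter Topology

lemma exists_le_norm_omega (A : ℝ) :
    ∃ T : ℝ, 2 ≤ T ∧ ∀ s : ℂ, T ≤ s.im → Real.log ‖s‖ ≤ 2 * ‖omega s‖ ∧ A ≤ ‖omega s‖ := by
  obtain ⟨C, hC, h⟩ := exists_norm_omega_sub_log_le
  obtain ⟨T, hT⟩ := eventually_atTop.1
    (Real.tendsto_log_atTop.eventually_ge_atTop (max (2 * C) (C + A)))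
  refine ⟨max T 2, le_max_right _ _, fun s hs ↦ ?_⟩
  have hs₂ : 2 ≤ s.im := (le_max_right _ _).trans hs
  have h₁ : max (2 * C) (C + A) ≤ Real.log ‖s‖ :=
    (hT s.im ((le_max_left _ _).trans hs)).trans
      (Real.log_le_log (by linarith) ((le_abs_self _).trans (abs_im_le_norm s)))
  have h₂ : Real.log ‖s‖ ≤ ‖log s‖ := by
    rw [← log_re]
    exact (le_abs_self _).trans (abs_re_le_norm _)
  have h₃ := norm_sub_norm_le (log s) (omega s)
  rw [norm_sub_rev] at h₃
  have h₄ := h s (by linarith)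
  have h₅ := (le_max_left _ _).trans h₁
  have h₆ := (le_max_right _ _).trans h₁
  constructor <;> linarith

lemma differentiableAt_omega {s : ℂ} (hs : 0 < s.im) : DifferentiableAt ℂ omega s :=
  differentiableOn_omega.differentiableAt (isOpen_im_pos.mem_nhds hs)

lemma exists_norm_deriv_omega_le :
    ∃ D : ℝ, 0 < D ∧ ∀ s : ℂ, 2 ≤ s.im → ‖deriv omega s‖ ≤ D := by
  obtain ⟨C, hC, h⟩ := exists_norm_omega_sub_log_le
  refine ⟨C + 1, by linarith, fun s hs ↦ ?_⟩
  have him (z : ℂ) (hz : z ∈ closedBall s 1) : 1 ≤ z.im := by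
    have := (abs_im_le_norm _).trans (mem_closedBall_iff_norm.1 hz)
    rw [sub_im] at this
    linarith [(abs_le.1 this).1]
  have hlog {z : ℂ} (hz : 0 < z.im) : z ∈ slitPlane := Or.inr hz.ne'
  have hcauchy := norm_deriv_le_of_forall_mem_sphere_norm_le (f := fun z ↦ omega z - log z)
    (c := s) one_pos
    (DifferentiableOn.diffContOnCl_ball (U := closedBall s 1) (fun z hz ↦
      have hz₀ : 0 < z.im := by linarith [him z hz]
      ((differentiableAt_omega hz₀).sub
        (differentiableAt_log (hlog hz₀))).differentiableWithinAt) le_rfl)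
    (fun z hz ↦ h z (him z (sphere_subset_closedBall hz)))
  have hs₀ : 0 < s.im := by linarith
  have hd := (differentiableAt_omega hs₀).hasDerivAt.sub (hasDerivAt_log (hlog hs₀))
  have hd' : deriv (fun z ↦ omega z - log z) s = deriv omega s - s⁻¹ := hd.deriv
  rw [hd', div_one] at hcauchy
  have hinv : ‖s⁻¹‖ ≤ 1 := by
    rw [norm_inv]
    apply inv_le_one_of_one_le₀
    linarith [(le_abs_self _).trans (abs_im_le_norm s)]
  calc ‖deriv omega s‖ = ‖(deriv omega s - s⁻¹) + s⁻¹‖ := by rw [sub_add_cancel]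
    _ ≤ C + 1 := (norm_add_le _ _).trans (add_le_add hcauchy hinv)

lemma norm_omega_le_add {D : ℝ} (hD : ∀ s : ℂ, 2 ≤ s.im → ‖deriv omega s‖ ≤ D) {s z : ℂ}
    (hs : 2 ≤ s.im) (hz : 2 ≤ z.im) (hsz : ‖z - s‖ ≤ 1) : ‖omega z‖ ≤ ‖omega s‖ + D := by
  have hD₀ : 0 ≤ D := (norm_nonneg _).trans (hD s hs)
  have := (convex_halfSpace_im_ge 2).norm_image_sub_le_of_norm_deriv_le (𝕜 := ℂ) (f := omega)
    (fun w hw ↦ differentiableAt_omega (lt_of_lt_of_le two_pos hw)) hD hs hz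
  have h₂ := norm_sub_norm_le (omega z) (omega s)
  nlinarith

end Omega

section Base

/-- In the part of the upper half-plane where `φ > 1 / 2`, the logarithmic derivative of `Z` is
asymptotic to `c * omega`, in a weak uniform sense. -/
def LogDerivAsymp (φ : ℂ → ℝ) (c : ℂ) (Z : ℂ → ℂ) : Prop :=
  ∀ a : ℝ, 1 / 2 < a → ∀ ε : ℝ, 0 < ε → ∃ T : ℝ, ∀ s : ℂ, a ≤ φ s → T ≤ s.im →
    Z s ≠ 0 ∧ ‖deriv Z s / Z s - c * omega s‖ ≤ ε * ‖omega s‖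

lemma ne_one_of_im_pos {s : ℂ} (hs : 0 < s.im) : s ≠ 1 := by
  rintro rfl
  simp at hs

lemma RiemannHypothesis.logDerivAsymp_re (hRH : RiemannHypothesis) :
    LogDerivAsymp re 0 riemannZeta := by
  intro a ha ε hε
  obtain ⟨T, hT, h⟩ := hRH.exists_norm_logDeriv_zeta_le ha (half_pos hε)
  obtain ⟨T', hT', h'⟩ := exists_le_norm_omega 0
  refine ⟨max T T', fun s hs hst ↦ ?_⟩
  have h₁ : T ≤ s.im := (le_max_left _ _).trans hst
  refine ⟨hRH.riemannZeta_ne_zero (by linarith) (ne_one_of_im_pos (by linarith)), ?_⟩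
  rw [zero_mul, sub_zero]
  refine (h s hs (h₁.trans (le_abs_self _))).trans ?_
  have := (h' s ((le_max_right _ _).trans hst)).1
  nlinarith

lemma logDeriv_zeta_one_sub {s : ℂ} (hs : 0 < s.im) (hζ : riemannZeta (1 - s) ≠ 0) :
    riemannZeta s ≠ 0 ∧ deriv riemannZeta s / riemannZeta s + omega s =
      2 * Real.log (2 * Real.pi) -
        deriv riemannZeta (1 - s) / riemannZeta (1 - s) := by
  have hfe (z : ℂ) (hz : 0 < z.im) : riemannZeta (1 - z) =
      2 * (2 * Real.pi) ^ (-z) * Gamma z * cos (Real.pi * z / 2) * riemannZeta z :=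
    riemannZeta_one_sub (fun n h ↦ by simp [h] at hz) (ne_one_of_im_pos hz)
  have hζs : riemannZeta s ≠ 0 := fun h ↦ hζ (by rw [hfe s hs, h, mul_zero])
  refine ⟨hζs, ?_⟩
  have hpi : (2 * Real.pi : ℂ) ≠ 0 := by simp [Real.pi_ne_zero]
  have hs₁ : 1 - s ≠ 1 := by
    intro h
    have := congrArg im h
    simp at this
    linarith
  have hL : HasDerivAt (fun z ↦ riemannZeta (1 - z)) (-deriv riemannZeta (1 - s)) s :=
    (differentiableAt_riemannZeta hs₁).hasDerivAt.comp_const_sub 1 s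
  have hpow : HasDerivAt (fun z : ℂ ↦ (2 * Real.pi : ℂ) ^ (-z))
      ((2 * Real.pi : ℂ) ^ (-s) * log (2 * Real.pi) * -1) s :=
    (hasDerivAt_neg s).const_cpow (Or.inl hpi)
  have hΓ := (differentiableAt_Gamma_of_im_pos hs).hasDerivAt
  have hcos : HasDerivAt (fun z : ℂ ↦ cos (Real.pi * z / 2))
      (-sin (Real.pi * s / 2) * (Real.pi / 2)) s := by
    have : HasDerivAt (fun z : ℂ ↦ (Real.pi : ℂ) * z / 2) (Real.pi / 2) s := by
      simpa using ((hasDerivAt_id s).const_mul (Real.pi : ℂ)).div_const 2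
    exact this.ccos
  have hR := (((hpow.const_mul 2).fun_mul hΓ).fun_mul hcos).fun_mul
    (differentiableAt_riemannZeta (ne_one_of_im_pos hs)).hasDerivAt
  have heq : (fun z ↦ riemannZeta (1 - z)) =ᶠ[nhds s] fun z ↦
      2 * (2 * Real.pi : ℂ) ^ (-z) * Gamma z * cos (Real.pi * z / 2) * riemannZeta z :=
    Filter.eventuallyEq_of_mem (isOpen_im_pos.mem_nhds hs) hfe
  have hderiv := hL.unique (hR.congr_of_eventuallyEq heq)
  have hΓ₀ := Gamma_ne_zero_of_im_pos hs
  have hcos₀ := cos_ne_zero_of_im_pos (im_pi_mul_div_two_pos hs)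
  have hpow₀ : (2 * Real.pi : ℂ) ^ (-s) ≠ 0 := by simp [cpow_eq_zero_iff, Real.pi_ne_zero]
  have hlog : ((Real.log (2 * Real.pi) : ℝ) : ℂ) = log (2 * Real.pi) := by
    rw [ofReal_log (by positivity)]
    push_cast
    rfl
  rw [neg_eq_iff_eq_neg.1 hderiv, hfe s hs, omega, hlog, tan]
  field_simp
  ring

lemma RiemannHypothesis.logDerivAsymp_one_sub_re (hRH : RiemannHypothesis) :
    LogDerivAsymp (fun s ↦ 1 - s.re) (-1) riemannZeta := by
  intro a ha ε hε
  obtain ⟨T, hT, h⟩ := hRH.exists_norm_logDeriv_zeta_le ha (show 0 < ε / 8 by linarith)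
  obtain ⟨T', hT', h'⟩ := exists_le_norm_omega (2 / ε * (2 * Real.log (2 * Real.pi)))
  refine ⟨max T T', fun s hs hst ↦ ?_⟩
  have h₁ : T ≤ s.im := (le_max_left _ _).trans hst
  have hs₀ : 0 < s.im := by linarith
  have hs₂ : 2 ≤ ‖s‖ := by linarith [(le_abs_self _).trans (abs_im_le_norm s)]
  have h₂ : T ≤ |(1 - s).im| := by simpa [abs_of_pos hs₀] using h₁
  have hζ : riemannZeta (1 - s) ≠ 0 := hRH.riemannZeta_ne_zero
    (by simp only [sub_re, one_re]; linarith) (fun h ↦ by simp [h] at h₂; linarith)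
  obtain ⟨hne, heq⟩ := logDeriv_zeta_one_sub hs₀ hζ
  refine ⟨hne, ?_⟩
  rw [neg_one_mul, sub_neg_eq_add, heq]
  obtain ⟨h₃, h₄⟩ := h' s ((le_max_right _ _).trans hst)
  have h₅ := h (1 - s) (by simpa using hs) h₂
  have hpos : 0 < ‖1 - s‖ := by linarith [abs_im_le_norm (1 - s)]
  have h₆ : Real.log ‖1 - s‖ ≤ 2 * Real.log ‖s‖ := by
    have : ‖1 - s‖ ≤ ‖s‖ ^ 2 := by
      have := norm_sub_le 1 s
      rw [norm_one] at this
      nlinarith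
    have := Real.log_le_log hpos this
    rwa [Real.log_pow] at this
  have h₇ : 2 * Real.log (2 * Real.pi) ≤ ε / 2 * ‖omega s‖ := by
    calc 2 * Real.log (2 * Real.pi) = ε / 2 * (2 / ε * (2 * Real.log (2 * Real.pi))) := by
          field_simp
      _ ≤ _ := by gcongr
  have h₈ : ‖(2 : ℂ) * (Real.log (2 * Real.pi) : ℝ)‖ = 2 * Real.log (2 * Real.pi) := by
    have : 0 ≤ Real.log (2 * Real.pi) := Real.log_nonneg (by linarith [Real.pi_gt_three])
    rw [norm_mul, norm_ofNat, norm_real, Real.norm_of_nonneg this]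
  refine (norm_sub_le _ _).trans ?_
  rw [h₈]
  nlinarith

end Base

section InductiveStep

open Metric

lemma LogDerivAsymp.deriv_sub {φ : ℂ → ℝ} (hφ : ∀ z w, |φ z - φ w| ≤ ‖z - w‖) {c : ℂ}
    (hc : c ≠ 1 / 2) {Z : ℂ → ℂ} (hZ : DifferentiableOn ℂ Z {s | 0 < s.im})
    (h : LogDerivAsymp φ c Z) :
    LogDerivAsymp φ c fun s ↦ deriv Z s - (1 / 2) * omega s * Z s := by
  intro a ha ε hε
  set κ : ℝ := ‖c - 1 / 2‖ with hκ_def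
  have hκ : 0 < κ := norm_pos_iff.2 (sub_ne_zero.2 hc)
  set r : ℝ := min 1 ((a - 1 / 2) / 2) with hr_def
  have hr : 0 < r := lt_min one_pos (by linarith)
  have hr₁ : r ≤ 1 := min_le_left _ _
  have hra : r ≤ (a - 1 / 2) / 2 := min_le_right _ _
  obtain ⟨D, hD, hωD⟩ := exists_norm_deriv_omega_le
  obtain ⟨T₁, hT₁⟩ := h ((a + 1 / 2) / 2) (by linarith) (min 1 (min (ε / 2) (κ / 2)))
    (by positivity)
  obtain ⟨T₂, hT₂, hω⟩ := exists_le_norm_omega (max (max 1 D) (2 / ε * (4 / (r * κ) + 2 * D)))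
  refine ⟨max (T₁ + 1) (T₂ + 1), fun s hs hst ↦ ?_⟩
  have hball (z : ℂ) (hz : z ∈ closedBall s r) :
      (a + 1 / 2) / 2 ≤ φ z ∧ T₁ ≤ z.im ∧ 2 ≤ z.im ∧ ‖z - s‖ ≤ 1 := by
    have hz' := mem_closedBall_iff_norm.1 hz
    have h₁ := abs_le.1 ((hφ z s).trans hz')
    have h₂ := abs_le.1 ((abs_im_le_norm (z - s)).trans hz')
    rw [sub_im] at h₂
    have h₃ := (le_max_left _ _).trans hst
    have h₄ := (le_max_right _ _).trans hst
    refine ⟨?_, ?_, ?_, ?_⟩ <;> linarith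
  obtain ⟨hsφ, hsT, hs₂, -⟩ := hball s (mem_closedBall_self hr.le)
  obtain ⟨hZs, hgs⟩ := hT₁ s hsφ hsT
  obtain ⟨-, hωs⟩ := hω s (by linarith [(le_max_right _ _).trans hst])
  have hω₁ : 1 ≤ ‖omega s‖ := (le_max_left _ _).trans ((le_max_left _ _).trans hωs)
  have hω₂ : D ≤ ‖omega s‖ := (le_max_right _ _).trans ((le_max_left _ _).trans hωs)
  have hω₃ : 2 / ε * (4 / (r * κ) + 2 * D) ≤ ‖omega s‖ := (le_max_right _ _).trans hωs
  set g : ℂ → ℂ := fun z ↦ deriv Z z / Z z - c * omega z with hg_def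
  have hgd (z : ℂ) (hz : z ∈ closedBall s r) : DifferentiableAt ℂ g z := by
    obtain ⟨h₁, h₂, h₃, -⟩ := hball z hz
    have hz₀ : 0 < z.im := by linarith
    have hmem := isOpen_im_pos.mem_nhds hz₀
    exact (((hZ.deriv isOpen_im_pos).differentiableAt hmem).div (hZ.differentiableAt hmem)
      (hT₁ z h₁ h₂).1).sub ((differentiableAt_omega hz₀).const_mul c)
  have hg' : ‖deriv g s‖ ≤ 2 * ‖omega s‖ / r := by
    refine norm_deriv_le_of_forall_mem_sphere_norm_le hr
      (DifferentiableOn.diffContOnCl_ball (U := closedBall s r)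
        (fun z hz ↦ (hgd z hz).differentiableWithinAt) le_rfl) fun z hz ↦ ?_
    obtain ⟨h₁, h₂, h₃, h₄⟩ := hball z (sphere_subset_closedBall hz)
    calc ‖g z‖ ≤ min 1 (min (ε / 2) (κ / 2)) * ‖omega z‖ := (hT₁ z h₁ h₂).2
      _ ≤ 1 * ‖omega z‖ := by gcongr; exact min_le_left _ _
      _ ≤ 2 * ‖omega s‖ := by linarith [norm_omega_le_add hωD hs₂ h₃ h₄]
  have hs₀ : 0 < s.im := by linarith
  have hu := (hgd s (mem_closedBall_self hr.le)).hasDerivAt.fun_add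
    ((differentiableAt_omega hs₀).hasDerivAt.const_mul (c - 1 / 2))
  set u : ℂ → ℂ := fun z ↦ g z + (c - 1 / 2) * omega z with hu_def
  have hus : κ / 2 * ‖omega s‖ ≤ ‖u s‖ := by
    have h₁ : ‖g s‖ ≤ κ / 2 * ‖omega s‖ := hgs.trans (by
      gcongr
      exact (min_le_right _ _).trans (min_le_right _ _))
    have h₂ := norm_sub_norm_le ((c - 1 / 2) * omega s) (-g s)
    rw [norm_neg, sub_neg_eq_add, norm_mul, add_comm ((c - 1 / 2) * omega s)] at h₂
    change κ / 2 * ‖omega s‖ ≤ ‖g s + (c - 1 / 2) * omega s‖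
    linarith
  have hu₀ : u s ≠ 0 := norm_pos_iff.1 (lt_of_lt_of_le (by positivity) hus)
  have heq : (fun z ↦ deriv Z z - (1 / 2) * omega z * Z z) =ᶠ[nhds s] fun z ↦ Z z * u z := by
    filter_upwards [closedBall_mem_nhds s hr] with z hz
    obtain ⟨h₁, h₂, -⟩ := hball z hz
    have := (hT₁ z h₁ h₂).1
    simp only [hu_def, hg_def]
    field_simp
    ring
  have hW := ((hZ.differentiableAt (isOpen_im_pos.mem_nhds hs₀)).hasDerivAt.fun_mul
    hu).congr_of_eventuallyEq heq
  refine ⟨by beta_reduce; rw [heq.eq_of_nhds]; exact mul_ne_zero hZs hu₀, ?_⟩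
  rw [hW.deriv]
  beta_reduce
  rw [heq.eq_of_nhds]
  have hsplit : (deriv Z s * u s + Z s * (deriv g s + (c - 1 / 2) * deriv omega s)) /
      (Z s * u s) - c * omega s =
        g s + (deriv g s + (c - 1 / 2) * deriv omega s) / u s := by
    simp only [hg_def]
    field_simp
    ring
  rw [hsplit]
  have hu' : ‖deriv g s + (c - 1 / 2) * deriv omega s‖ ≤ 2 * ‖omega s‖ / r + κ * D := by
    refine (norm_add_le _ _).trans (add_le_add hg' ?_)
    rw [norm_mul]
    gcongr
    exact hωD s hs₂
  have hquot : ‖(deriv g s + (c - 1 / 2) * deriv omega s) / u s‖ ≤ ε / 2 * ‖omega s‖ := by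
    rw [norm_div]
    calc ‖deriv g s + (c - 1 / 2) * deriv omega s‖ / ‖u s‖
        ≤ (2 * ‖omega s‖ / r + κ * D) / (κ / 2 * ‖omega s‖) := by gcongr
      _ ≤ (2 * ‖omega s‖ / r + κ * (D * ‖omega s‖)) / (κ / 2 * ‖omega s‖) := by
          gcongr
          exact le_mul_of_one_le_right hD.le hω₁
      _ = ε / 2 * (2 / ε * (4 / (r * κ) + 2 * D)) := by field_simp; ring
      _ ≤ _ := by gcongr
  calc ‖g s + (deriv g s + (c - 1 / 2) * deriv omega s) / u s‖
      ≤ ε / 2 * ‖omega s‖ + ε / 2 * ‖omega s‖ := by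
        refine (norm_add_le _ _).trans (add_le_add (hgs.trans ?_) hquot)
        gcongr
        exact (min_le_right _ _).trans (min_le_left _ _)
    _ = ε * ‖omega s‖ := by ring

lemma differentiableOn_Zk (k : ℕ) : DifferentiableOn ℂ (Zk k) {s | 0 < s.im} := by
  induction k with
  | zero => exact fun s hs ↦
      (differentiableAt_riemannZeta (ne_one_of_im_pos hs)).differentiableWithinAt
  | succ k ih => exact (ih.deriv isOpen_im_pos).sub ((differentiableOn_omega.const_mul _).mul ih)

lemma LogDerivAsymp.Zk {φ : ℂ → ℝ} (hφ : ∀ z w, |φ z - φ w| ≤ ‖z - w‖) {c : ℂ}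
    (hc : c ≠ 1 / 2) (h : LogDerivAsymp φ c riemannZeta) (k : ℕ) :
    LogDerivAsymp φ c (Zk k) := by
  induction k with
  | zero => exact h
  | succ k ih => exact ih.deriv_sub hφ hc (differentiableOn_Zk k)

end InductiveStep

/-- under RH, every zero of `Z_k` with large imaginary part lying off the
critical line is within distance `1/9` of the line `σ = 1/2`. -/
theorem off_line_zeros_close (hRH : RiemannHypothesis) (k : ℕ) :
    ∃ t₀ > (0 : ℝ), ∀ ρ : ℂ, Zk k ρ = 0 → t₀ ≤ ρ.im → ρ.re ≠ 1 / 2 →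
      |ρ.re - 1 / 2| ≤ 1 / 9 := by
  have hre (z w : ℂ) : |z.re - w.re| ≤ ‖z - w‖ := abs_re_le_norm (z - w)
  obtain ⟨T₁, h₁⟩ := hRH.logDerivAsymp_re.Zk hre (by norm_num) k (1 / 2 + 1 / 9) (by norm_num)
    1 one_pos
  obtain ⟨T₂, h₂⟩ := hRH.logDerivAsymp_one_sub_re.Zk
    (fun z w ↦ by rw [sub_sub_sub_cancel_left, abs_sub_comm]; exact hre z w)
    (by norm_num) k (1 / 2 + 1 / 9) (by norm_num) 1 one_pos
  refine ⟨max 1 (max T₁ T₂), by positivity, fun ρ hρ ht _ ↦ ?_⟩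
  have ht₁ : T₁ ≤ ρ.im := (le_max_left _ _).trans ((le_max_right _ _).trans ht)
  have ht₂ : T₂ ≤ ρ.im := (le_max_right _ _).trans ((le_max_right _ _).trans ht)
  rw [abs_le]
  constructor
  · by_contra! hlt
    exact (h₂ ρ (by linarith) ht₂).1 hρ
  · by_contra! hlt
    exact (h₁ ρ (by linarith) ht₁).1 hρ
end

section
/- For all non-negative integers j and u with u ≤ j, one has the identity Σ_{μ=0}^{j−u} binom(2j+1−u, μ) · Σ_{ν=0}^{j} binom(2j+1−u−μ, ν) · (−2)^{2j+1−u−μ−ν} = (−1)^{j+1} (1 + (−1)^{u}) binom(2j−u, j), as an identity of integers. -/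
open Finset

/-- The binomial expansion of `(1 + (-2)) ^ m`, truncated to its first `B` terms. -/
def truncBinom (B m : ℕ) : ℤ :=
  ∑ ν ∈ Finset.range B, (Nat.choose m ν : ℤ) * (-2 : ℤ) ^ (m - ν)

/-- The trinomial expansion of `(1 + 1 + (-2)) ^ n`, truncated to exponents less than `A` and `B`
of the two ones. -/
def truncTrinom (A B n : ℕ) : ℤ :=
  ∑ μ ∈ Finset.range A, (Nat.choose n μ : ℤ) * truncBinom B (n - μ)

theorem choose_mul_apply_succ_sub (n k : ℕ) (f : ℕ → ℤ) :
    (Nat.choose n k : ℤ) * f (n + 1 - k) = (Nat.choose n k : ℤ) * f (n - k + 1) := by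
  rcases le_or_gt k n with h | h
  · rw [Nat.sub_add_comm h]
  · simp [Nat.choose_eq_zero_of_lt h]

/-- Pascal's rule for truncated binomial convolutions. -/
theorem sum_range_choose_succ_mul (A n : ℕ) (f : ℕ → ℤ) :
    ∑ k ∈ Finset.range (A + 1), (Nat.choose (n + 1) k : ℤ) * f (n + 1 - k) =
      ∑ k ∈ Finset.range A, (Nat.choose n k : ℤ) * f (n - k) +
        ∑ k ∈ Finset.range (A + 1), (Nat.choose n k : ℤ) * f (n - k + 1) := by
  simp_rw [← choose_mul_apply_succ_sub]
  rw [Finset.sum_range_succ', Finset.sum_range_succ' _ A, ← add_assoc, ← Finset.sum_add_distrib]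
  simp [Nat.choose_succ_succ, add_mul]

theorem truncBinom_succ_succ (B m : ℕ) :
    truncBinom (B + 1) (m + 1) = truncBinom B m - 2 * truncBinom (B + 1) m := by
  unfold truncBinom
  rw [sum_range_choose_succ_mul B m fun i => (-2) ^ i, sub_eq_add_neg, Finset.mul_sum,
    ← Finset.sum_neg_distrib]
  congr 1
  exact Finset.sum_congr rfl fun _ _ => by ring

theorem truncTrinom_succ_succ_succ (A B n : ℕ) :
    truncTrinom (A + 1) (B + 1) (n + 1) =
      truncTrinom A (B + 1) n + truncTrinom (A + 1) B n - 2 * truncTrinom (A + 1) (B + 1) n := by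
  unfold truncTrinom
  rw [sum_range_choose_succ_mul, add_sub_assoc, Finset.mul_sum, ← Finset.sum_sub_distrib]
  congr 1
  exact Finset.sum_congr rfl fun _ _ => by rw [truncBinom_succ_succ]; ring

theorem truncTrinom_zero_left (B n : ℕ) : truncTrinom 0 B n = 0 := by
  simp [truncTrinom]

theorem truncTrinom_zero_right (A n : ℕ) : truncTrinom A 0 n = 0 := by
  simp [truncTrinom, truncBinom]

theorem truncTrinom_succ_succ_zero (A B : ℕ) : truncTrinom (A + 1) (B + 1) 0 = 1 := by
  simp [truncTrinom, truncBinom, Finset.sum_range_succ']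

theorem truncTrinom_eq (m a b : ℕ) (h : m ≤ a + b) :
    truncTrinom (a + 1) (b + 1) (m + 1) =
      (-1) ^ (m + 1) * ((-1) ^ a * (Nat.choose m a : ℤ) + (-1) ^ b * (Nat.choose m b : ℤ)) := by
  induction m generalizing a b with
  | zero =>
    rw [truncTrinom_succ_succ_succ]
    rcases a with _ | a <;> rcases b with _ | b <;>
      simp [truncTrinom_zero_left, truncTrinom_zero_right, truncTrinom_succ_succ_zero]
  | succ m ih =>
    rw [truncTrinom_succ_succ_succ, ih a b (by omega)]
    rcases a with _ | a <;> rcases b with _ | b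
    · omega
    · rw [truncTrinom_zero_left, ih 0 b (by omega), Nat.choose_succ_succ m b,
        Nat.choose_eq_zero_of_lt (show m < b + 1 by omega)]
      push_cast [Nat.choose_zero_right]
      ring
    · rw [truncTrinom_zero_right, ih a 0 (by omega), Nat.choose_succ_succ m a,
        Nat.choose_eq_zero_of_lt (show m < a + 1 by omega)]
      push_cast [Nat.choose_zero_right]
      ring
    · rw [ih a (b + 1) (by omega), ih (a + 1) b (by omega), Nat.choose_succ_succ m a,
        Nat.choose_succ_succ m b]
      push_cast
      ring

/-- for `u ≤ j`,
`Σ_{μ=0}^{j−u} C(2j+1−u, μ) Σ_{ν=0}^{j} C(2j+1−u−μ, ν) (−2)^{2j+1−u−μ−ν}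
  = (−1)^{j+1} (1 + (−1)^u) C(2j−u, j)` in `ℤ`. -/
theorem binom_identity (j u : ℕ) (hu : u ≤ j) :
    ∑ μ ∈ Finset.range (j - u + 1), (Nat.choose (2 * j + 1 - u) μ : ℤ) *
      ∑ ν ∈ Finset.range (j + 1), (Nat.choose (2 * j + 1 - u - μ) ν : ℤ) *
        (-2 : ℤ) ^ (2 * j + 1 - u - μ - ν)
    = (-1 : ℤ) ^ (j + 1) * (1 + (-1 : ℤ) ^ u) * Nat.choose (2 * j - u) j := by
  obtain ⟨a, rfl⟩ := Nat.exists_eq_add_of_le hu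
  have key := truncTrinom_eq (2 * a + u) a (u + a) (by omega)
  have hsymm : Nat.choose (2 * a + u) a = Nat.choose (2 * a + u) (u + a) :=
    Nat.choose_symm_of_eq_add (by omega)
  rw [hsymm] at key
  simp only [truncTrinom, truncBinom] at key
  rw [show u + a - u = a by omega, show 2 * (u + a) + 1 - u = 2 * a + u + 1 by omega,
    show 2 * (u + a) - u = 2 * a + u by omega, key]
  rcases neg_one_pow_eq_or ℤ u with h | h <;> simp only [pow_add, pow_mul, h] <;> ring
end

section
/- For every non-negative integer j, one has the identity Σ_{μ=0}^{j} Σ_{ν=0}^{j} binom(j, μ) · binom(j, ν) · ( μ! ν! / (μ+ν+2)! ) · (−1/2)^{2j−μ−ν} = (1 + (−1)^{j}) / ( 2^{2j+2} (j+1)^2 ), as an identity of rational numbers. -/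
open Finset

theorem integral_pow_mul_one_sub_pow (m n : ℕ) :
    ∫ x in (0 : ℝ)..1, x ^ m * (1 - x) ^ n =
      (m.factorial : ℝ) * n.factorial / (m + n + 1).factorial := by
  induction n generalizing m with
  | zero =>
    simp only [pow_zero, mul_one, integral_pow, Nat.factorial_zero, Nat.cast_one, add_zero,
      Nat.factorial_succ m]
    have := m.factorial_pos
    push_cast
    field_simp
    simp
  | succ n ih =>
    have hderiv : ∀ x ∈ Set.uIcc (0 : ℝ) 1,
        HasDerivAt (fun x : ℝ => x ^ (m + 1) * (1 - x) ^ (n + 1))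
          ((m + 1) * (x ^ m * (1 - x) ^ (n + 1)) - (n + 1) * (x ^ (m + 1) * (1 - x) ^ n)) x := by
      intro x _
      refine ((hasDerivAt_pow (m + 1) x).fun_mul
        (((hasDerivAt_id' x).const_sub 1).fun_pow (n + 1))).congr_deriv ?_
      simp only [add_tsub_cancel_right]
      push_cast
      ring
    have hparts := intervalIntegral.integral_eq_sub_of_hasDerivAt hderiv
      (Continuous.intervalIntegrable (by fun_prop) _ _)
    rw [intervalIntegral.integral_sub (Continuous.intervalIntegrable (by fun_prop) _ _)
      (Continuous.intervalIntegrable (by fun_prop) _ _), intervalIntegral.integral_const_mul,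
      intervalIntegral.integral_const_mul, ih (m + 1)] at hparts
    rw [show m + 1 + n + 1 = m + (n + 1) + 1 by ring, Nat.factorial_succ m] at hparts
    rw [Nat.factorial_succ n]
    have hm : (m : ℝ) + 1 ≠ 0 := by positivity
    apply mul_left_cancel₀ hm
    simp at hparts
    push_cast
    linear_combination hparts

theorem sum_choose_mul_pow_succ_div {K : Type*} [Field K] [CharZero K] (j : ℕ) (t c : K) :
    ∑ k ∈ range (j + 1), (j.choose k : K) * (t ^ (k + 1) / (k + 1)) * c ^ (j - k) =
      ((t + c) ^ (j + 1) - c ^ (j + 1)) / (j + 1) := by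
  have hj : (j : K) + 1 ≠ 0 := by exact_mod_cast j.succ_ne_zero
  rw [add_pow, sum_range_succ' _ (j + 1), eq_div_iff hj, sum_mul]
  simp only [pow_zero, one_mul, Nat.choose_zero_right, Nat.cast_one, mul_one, tsub_zero,
    add_sub_cancel_right, Nat.add_sub_add_right]
  refine sum_congr rfl fun k _ => ?_
  have hk : (k : K) + 1 ≠ 0 := by exact_mod_cast k.succ_ne_zero
  have hchoose : ((j : K) + 1) * j.choose k = (j + 1).choose (k + 1) * (k + 1) := by
    exact_mod_cast Nat.add_one_mul_choose_eq j k
  field_simp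
  linear_combination (t ^ (k + 1) * c ^ (j - k)) * hchoose

theorem integral_sub_half_pow (n : ℕ) :
    ∫ x in (0 : ℝ)..1, (x - 1 / 2) ^ n = (1 + (-1) ^ n) / (2 ^ (n + 1) * (n + 1)) := by
  rw [intervalIntegral.integral_comp_sub_right (fun x : ℝ => x ^ n), integral_pow,
    show (1 : ℝ) - 1 / 2 = 1 / 2 by norm_num, show (0 : ℝ) - 1 / 2 = -1 * (1 / 2) by norm_num,
    mul_pow, div_pow, one_pow]
  field_simp
  ring

theorem sum_choose_mul_beta_eq_integral (j : ℕ) (c : ℝ) :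
    ∑ μ ∈ range (j + 1), ∑ ν ∈ range (j + 1),
      (j.choose μ : ℝ) * j.choose ν *
        ((μ.factorial : ℝ) * ν.factorial / (μ + ν + 2).factorial) * c ^ (2 * j - μ - ν) =
      ∫ x in (0 : ℝ)..1, (x + c) ^ j * (((1 - x + c) ^ (j + 1) - c ^ (j + 1)) / (j + 1)) := by
  simp_rw [← sum_choose_mul_pow_succ_div, add_pow _ _ j, sum_mul_sum]
  rw [intervalIntegral.integral_finsetSum
    fun μ _ => Continuous.intervalIntegrable (by fun_prop) _ _]
  refine sum_congr rfl fun μ hμ => ?_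
  rw [intervalIntegral.integral_finsetSum
    fun ν _ => Continuous.intervalIntegrable (by fun_prop) _ _]
  refine sum_congr rfl fun ν hν => ?_
  rw [mem_range] at hμ hν
  rw [show 2 * j - μ - ν = (j - μ) + (j - ν) by lia, pow_add]
  have hintegrand : ∀ x : ℝ, x ^ μ * c ^ (j - μ) * (j.choose μ : ℝ) *
      ((j.choose ν : ℝ) * ((1 - x) ^ (ν + 1) / (ν + 1)) * c ^ (j - ν)) =
      ((j.choose μ : ℝ) * j.choose ν * (c ^ (j - μ) * c ^ (j - ν)) / (ν + 1)) *
        (x ^ μ * (1 - x) ^ (ν + 1)) := fun x => by ring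
  simp_rw [hintegrand]
  rw [intervalIntegral.integral_const_mul, integral_pow_mul_one_sub_pow, Nat.factorial_succ ν,
    show μ + (ν + 1) + 1 = μ + ν + 2 by ring]
  push_cast
  field_simp

/-- `Σ_{μ=0}^{j} Σ_{ν=0}^{j} C(j,μ) C(j,ν) (μ! ν! / (μ+ν+2)!) (−1/2)^{2j−μ−ν}
  = (1 + (−1)^j) / (2^{2j+2} (j+1)²)` in `ℚ`. -/
theorem binom_factorial_identity (j : ℕ) :
    ∑ μ ∈ Finset.range (j + 1), ∑ ν ∈ Finset.range (j + 1),
      (Nat.choose j μ : ℚ) * (Nat.choose j ν : ℚ) *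
        ((Nat.factorial μ : ℚ) * (Nat.factorial ν : ℚ) / (Nat.factorial (μ + ν + 2) : ℚ)) *
          (-(1 / 2) : ℚ) ^ (2 * j - μ - ν)
    = (1 + (-1 : ℚ) ^ j) / (2 ^ (2 * j + 2) * ((j : ℚ) + 1) ^ 2) := by
  rw [← Rat.cast_inj (α := ℝ)]
  push_cast
  rw [sum_choose_mul_beta_eq_integral]
  have hintegrand : ∀ x : ℝ, (x + -(1 / 2)) ^ j *
      (((1 - x + -(1 / 2)) ^ (j + 1) - (-(1 / 2)) ^ (j + 1)) / (j + 1)) =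
      (-1) ^ (j + 1) / (j + 1) * (x - 1 / 2) ^ (2 * j + 1) -
        (-1) ^ (j + 1) / (2 ^ (j + 1) * (j + 1)) * (x - 1 / 2) ^ j := fun x => by
    rw [show 1 - x + -(1 / 2) = -1 * (x - 1 / 2) by ring,
      show (-(1 / 2) : ℝ) = -1 * (1 / 2) by ring, mul_pow, mul_pow, div_pow, one_pow]
    field_simp
    ring
  simp_rw [hintegrand]
  rw [intervalIntegral.integral_sub (Continuous.intervalIntegrable (by fun_prop) _ _)
    (Continuous.intervalIntegrable (by fun_prop) _ _), intervalIntegral.integral_const_mul,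
    intervalIntegral.integral_const_mul, integral_sub_half_pow, integral_sub_half_pow,
    (odd_two_mul_add_one j).neg_one_pow, add_neg_cancel, zero_div, mul_zero, zero_sub,
    pow_succ (-1 : ℝ)]
  rcases neg_one_pow_eq_or ℝ j with h | h <;> rw [h] <;> field_simp <;> ring
end
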